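/- John's differential equation: let F : ℝ³ → ℝ³ be a Schwartz vector field and define g : (ℝ³ \ {0}) × ℝ³ → ℝ³ by g(θ, x) = ∫_{−∞}^{∞} F(x + sθ) ds. Then g is smooth and for all indices i, j ∈ {1,2,3}, all θ ≠ 0 and all x ∈ ℝ³, the mixed partial derivatives satisfy ∂²g/∂x_i ∂θ_j (θ, x) = ∂²g/∂x_j ∂θ_i (θ, x). -/

import Mathlib

open MeasureTheory

noncomputable section

/-- Physical space `ℝ³` with the Euclidean structure. -/
abbrev E3 : Type := EuclideanSpace ℝ (Fin 3)

/-- Partial derivative in the `j`-th coordinate direction. -/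
def pd (j : Fin 3) (f : E3 → ℝ) (x : E3) : ℝ :=
  fderiv ℝ f x (EuclideanSpace.single j 1)

/-- The curl of a vector field on `ℝ³`. -/
def curl3 (G : E3 → E3) (x : E3) : E3 :=
  (EuclideanSpace.equiv (Fin 3) ℝ).symm
    ![pd 1 (fun y => G y 2) x - pd 2 (fun y => G y 1) x,
      pd 2 (fun y => G y 0) x - pd 0 (fun y => G y 2) x,
      pd 0 (fun y => G y 1) x - pd 1 (fun y => G y 0) x]

/-- The divergence of a vector field on `ℝ³`. -/
def div3 (G : E3 → E3) (x : E3) : ℝ := ∑ i, pd i (fun y => G y i) x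

/-- The gradient of a scalar field on `ℝ³`. -/
def grad3 (f : E3 → ℝ) (x : E3) : E3 :=
  (EuclideanSpace.equiv (Fin 3) ℝ).symm ![pd 0 f x, pd 1 f x, pd 2 f x]

/-- The Laplacian of a scalar field on `ℝ³`. -/
def lap3 (f : E3 → ℝ) (x : E3) : ℝ := ∑ i, pd i (pd i f) x

/-- The cross product on `ℝ³`. -/
def cross3 (a b : E3) : E3 :=
  (EuclideanSpace.equiv (Fin 3) ℝ).symm
    ![a 1 * b 2 - a 2 * b 1, a 2 * b 0 - a 0 * b 2, a 0 * b 1 - a 1 * b 0]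

/-- A Schwartz vector field: all components are Schwartz functions. -/
def IsSchwartzField (F : E3 → E3) : Prop :=
  ∀ i : Fin 3, ∃ g : SchwartzMap E3 ℝ, ∀ x, F x i = g x

/-- A Schwartz scalar function. -/
def IsSchwartzFn (f : E3 → ℝ) : Prop :=
  ∃ g : SchwartzMap E3 ℝ, ∀ x, f x = g x

/-- The Radon transform: integral of `F` over the plane `{z : κ·z = p}`,
with respect to the 2-dimensional Lebesgue measure on `κ⊥`. -/
def radon (F : E3 → E3) (p : ℝ) (κ : E3) : E3 :=
  ∫ y : (Submodule.span ℝ {κ})ᗮ, F (p • κ + (y : E3))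

/-- The X-ray transform of a vector field. -/
def xray (F : E3 → E3) (θ x : E3) : E3 := ∫ s : ℝ, F (x + s • θ)

/-- The X-ray transform of a scalar field. -/
def xrayS (f : E3 → ℝ) (θ x : E3) : ℝ := ∫ s : ℝ, f (x + s • θ)

/-- The Divergent beam (cone beam) transform of a vector field. -/
def dbeam (F : E3 → E3) (θ x : E3) : E3 := ∫ s in Set.Ioi (0 : ℝ), F (x + s • θ)

/-- The surface measure on the unit sphere `S² ⊂ ℝ³` (total mass `4π`). -/
def sphMeasure : Measure (Metric.sphere (0 : E3) 1) := (volume : Measure E3).toSphere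

open scoped SchwartzMap ContDiff
open Topology

universe u

section MomentXray

variable {V W : Type u} [NormedAddCommGroup V] [NormedSpace ℝ V]
  [NormedAddCommGroup W] [NormedSpace ℝ W]

/-- The `k`-th moment ray transform `∫ tᵏ f(x + tθ) dt`, at the point `p = (θ, x)`. -/
def momentXray (k : ℕ) (f : 𝓢(V, W)) (p : V × V) : W :=
  ∫ t : ℝ, t ^ k • f (p.2 + t • p.1)

/-- Near a pair with nonzero direction, the integrand of the moment ray transform is dominated by
a multiple of the integrable function `(1 + t²)⁻¹`. -/
lemma exists_nhds_bound_momentXray (k : ℕ) (f : 𝓢(V, W)) {p : V × V} (hp : p.1 ≠ 0) :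
    ∃ s ∈ 𝓝 p, ∃ C : ℝ, ∀ q ∈ s, ∀ t : ℝ,
      ‖t ^ k • f (q.2 + t • q.1)‖ ≤ C * (1 + t ^ 2)⁻¹ := by
  have hpos : 0 < ‖p.1‖ := norm_pos_iff.2 hp
  set c := ‖p.1‖ / 2 with hc
  set R := ‖p.2‖ + 1 with hR
  have hc0 : 0 < c := by positivity
  have hR0 : 0 < R := by positivity
  have hs : {q : V × V | c < ‖q.1‖ ∧ ‖q.2‖ < R} ∈ 𝓝 p := by
    refine IsOpen.mem_nhds ?_ ⟨by linarith, by linarith⟩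
    exact (isOpen_lt continuous_const continuous_fst.norm).inter
      (isOpen_lt continuous_snd.norm continuous_const)
  set B := 1 + (1 + R) / c with hB
  set M := 2 ^ (k + 2) * ((Finset.Iic (k + 2, 0)).sup
    (fun m => SchwartzMap.seminorm ℝ m.1 m.2)) f
  refine ⟨_, hs, B ^ (k + 2) * M, ?_⟩
  rintro q ⟨hq1, hq2⟩ t
  set y := q.2 + t • q.1 with hy
  have hdecay : (1 + ‖y‖) ^ (k + 2) * ‖f y‖ ≤ M := by
    simpa using SchwartzMap.one_add_le_sup_seminorm_apply (𝕜 := ℝ) (m := (k + 2, 0))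
      (k := k + 2) (n := 0) le_rfl le_rfl f y
  have ht : |t| * c ≤ ‖y‖ + R := by
    have h1 : ‖t • q.1‖ ≤ ‖y‖ + ‖q.2‖ := by
      have : t • q.1 = y - q.2 := by simp [hy]
      rw [this]
      exact norm_sub_le _ _
    rw [norm_smul, Real.norm_eq_abs] at h1
    nlinarith [mul_le_mul_of_nonneg_left hq1.le (abs_nonneg t)]
  have htB : 1 + |t| ≤ B * (1 + ‖y‖) := by
    have h2 : |t| ≤ (‖y‖ + R) / c := (le_div_iff₀ hc0).2 ht
    have h3 : (‖y‖ + R) / c ≤ (1 + R) / c * (1 + ‖y‖) := by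
      rw [div_mul_eq_mul_div]
      gcongr
      nlinarith [norm_nonneg y]
    rw [hB]
    nlinarith [norm_nonneg y]
  have hpow : |t| ^ k * (1 + t ^ 2) ≤ (1 + |t|) ^ (k + 2) := by
    rw [pow_add]
    have : 1 + t ^ 2 ≤ (1 + |t|) ^ 2 := by
      nlinarith [abs_nonneg t, sq_abs t]
    gcongr
    linarith
  rw [← div_eq_mul_inv, le_div_iff₀ (by positivity), norm_smul, norm_pow, Real.norm_eq_abs]
  calc |t| ^ k * ‖f y‖ * (1 + t ^ 2) = |t| ^ k * (1 + t ^ 2) * ‖f y‖ := by ring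
    _ ≤ (B * (1 + ‖y‖)) ^ (k + 2) * ‖f y‖ := by
      gcongr
      exact hpow.trans (by gcongr)
    _ = B ^ (k + 2) * ((1 + ‖y‖) ^ (k + 2) * ‖f y‖) := by rw [mul_pow]; ring
    _ ≤ B ^ (k + 2) * M := by gcongr

lemma continuous_momentXray_integrand (k : ℕ) (f : 𝓢(V, W)) (p : V × V) :
    Continuous fun t : ℝ => t ^ k • f (p.2 + t • p.1) := by
  have := f.continuous
  fun_prop

lemma integrable_momentXray_integrand (k : ℕ) (f : 𝓢(V, W)) {p : V × V} (hp : p.1 ≠ 0) :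
    Integrable fun t : ℝ => t ^ k • f (p.2 + t • p.1) := by
  obtain ⟨s, hs, C, hC⟩ := exists_nhds_bound_momentXray k f hp
  exact (integrable_inv_one_add_sq.const_mul C).mono'
    (continuous_momentXray_integrand k f p).aestronglyMeasurable
    (.of_forall fun t => hC p (mem_of_mem_nhds hs) t)

lemma hasFDerivAt_momentXray [CompleteSpace W] (k : ℕ) (f : 𝓢(V, W)) {p : V × V}
    (hp : p.1 ≠ 0) :
    HasFDerivAt (momentXray k f)
      ((momentXray k (SchwartzMap.fderivCLM ℝ V W f) p).comp (ContinuousLinearMap.snd ℝ V V) +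
        (momentXray (k + 1) (SchwartzMap.fderivCLM ℝ V W f) p).comp
          (ContinuousLinearMap.fst ℝ V V)) p := by
  set f' := SchwartzMap.fderivCLM ℝ V W f
  obtain ⟨s₀, hs₀, C₀, hC₀⟩ := exists_nhds_bound_momentXray k f' hp
  obtain ⟨s₁, hs₁, C₁, hC₁⟩ := exists_nhds_bound_momentXray (k + 1) f' hp
  let A : (V →L[ℝ] W) →L[ℝ] V × V →L[ℝ] W :=
    ContinuousLinearMap.precomp W (ContinuousLinearMap.snd ℝ V V)
  let B : (V →L[ℝ] W) →L[ℝ] V × V →L[ℝ] W :=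
    ContinuousLinearMap.precomp W (ContinuousLinearMap.fst ℝ V V)
  let G' : V × V → ℝ → V × V →L[ℝ] W := fun q t =>
    A (t ^ k • f' (q.2 + t • q.1)) + B (t ^ (k + 1) • f' (q.2 + t • q.1))
  have hA := integrable_momentXray_integrand k f' hp
  have hB := integrable_momentXray_integrand (k + 1) f' hp
  have hint : ∫ t, G' p t = A (momentXray k f' p) + B (momentXray (k + 1) f' p) := by
    rw [integral_add (A.integrable_comp hA) (B.integrable_comp hB),
      A.integral_comp_comm hA, B.integral_comp_comm hB]
    rfl
  change HasFDerivAt _ (A (momentXray k f' p) + B (momentXray (k + 1) f' p)) p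
  rw [← hint]
  refine hasFDerivAt_integral_of_dominated_of_fderiv_le (Filter.inter_mem hs₀ hs₁)
    (bound := fun t => ‖A‖ * (C₀ * (1 + t ^ 2)⁻¹) + ‖B‖ * (C₁ * (1 + t ^ 2)⁻¹))
    (.of_forall fun q => (continuous_momentXray_integrand k f q).aestronglyMeasurable)
    (integrable_momentXray_integrand k f hp) ?_ (.of_forall fun t q hq => ?_) ?_
    (.of_forall fun t q _ => ?_)
  · exact ((A.integrable_comp hA).add (B.integrable_comp hB)).aestronglyMeasurable
  · exact (norm_add_le _ _).trans (add_le_add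
      (A.le_opNorm_of_le (hC₀ q hq.1 t)) (B.le_opNorm_of_le (hC₁ q hq.2 t)))
  · exact ((integrable_inv_one_add_sq.const_mul C₀).const_mul _).add
      ((integrable_inv_one_add_sq.const_mul C₁).const_mul _)
  · have h1 : HasFDerivAt (fun q : V × V => q.2 + t • q.1)
        (ContinuousLinearMap.snd ℝ V V + t • ContinuousLinearMap.fst ℝ V V) q :=
      hasFDerivAt_snd.add (hasFDerivAt_fst.const_smul t)
    have h2 : HasFDerivAt f (f' (q.2 + t • q.1)) (q.2 + t • q.1) :=
      f.differentiableAt.hasFDerivAt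
    have h3 : HasFDerivAt (fun q : V × V => t ^ k • f (q.2 + t • q.1)) _ q :=
      (h2.comp q h1).const_smul (t ^ k)
    refine h3.congr_fderiv ?_
    ext v <;> simp [G', A, B, pow_succ, mul_smul]

/-- The moment ray transforms of a Schwartz function are smooth away from zero directions. -/
lemma contDiffOn_momentXray [CompleteSpace W] (k : ℕ) (f : 𝓢(V, W)) :
    ContDiffOn ℝ ∞ (momentXray k f) (({0}ᶜ : Set V) ×ˢ Set.univ) := by
  have hopen : IsOpen (({0}ᶜ : Set V) ×ˢ (Set.univ : Set V)) :=
    isOpen_compl_singleton.prod isOpen_univ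
  have hne {q : V × V} (hq : q ∈ ({0}ᶜ : Set V) ×ˢ (Set.univ : Set V)) : q.1 ≠ 0 := hq.1
  refine contDiffOn_infty.2 fun n => ?_
  induction n generalizing W k with
  | zero =>
    exact contDiffOn_zero.2 fun q hq =>
      (hasFDerivAt_momentXray k f (hne hq)).continuousAt.continuousWithinAt
  | succ n ih =>
    push_cast
    refine (contDiffOn_succ_iff_hasFDerivWithinAt_of_uniqueDiffOn hopen.uniqueDiffOn).2
      ⟨by simp, _, ?_, fun q hq => (hasFDerivAt_momentXray k f (hne hq)).hasFDerivWithinAt⟩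
    exact ((ih k _).clm_comp contDiffOn_const).add ((ih (k + 1) _).clm_comp contDiffOn_const)

lemma hasFDerivAt_momentXray_direction [CompleteSpace W] (k : ℕ) (f : 𝓢(V, W)) {θ : V}
    (hθ : θ ≠ 0) (x : V) :
    HasFDerivAt (fun θ' => momentXray k f (θ', x))
      (momentXray (k + 1) (SchwartzMap.fderivCLM ℝ V W f) (θ, x)) θ := by
  refine (HasFDerivAt.comp (g := momentXray k f) θ
    (hasFDerivAt_momentXray k f (p := (θ, x)) hθ)
    (hasFDerivAt_prodMk_left θ x)).congr_fderiv ?_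
  ext v
  simp

lemma hasFDerivAt_momentXray_base [CompleteSpace W] (k : ℕ) (f : 𝓢(V, W)) {θ : V}
    (hθ : θ ≠ 0) (x : V) :
    HasFDerivAt (fun x' => momentXray k f (θ, x'))
      (momentXray k (SchwartzMap.fderivCLM ℝ V W f) (θ, x)) x := by
  refine (HasFDerivAt.comp (g := momentXray k f) x
    (hasFDerivAt_momentXray k f (p := (θ, x)) hθ)
    (hasFDerivAt_prodMk_right θ x)).congr_fderiv ?_
  ext v
  simp

/-- The moment ray transform of the second derivative is a symmetric bilinear map. -/
lemma momentXray_fderiv_fderiv_symm [CompleteSpace W] (k : ℕ) (f : 𝓢(V, W)) {p : V × V}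
    (hp : p.1 ≠ 0) (v w : V) :
    momentXray k (SchwartzMap.fderivCLM ℝ V (V →L[ℝ] W) (SchwartzMap.fderivCLM ℝ V W f)) p v w =
      momentXray k (SchwartzMap.fderivCLM ℝ V (V →L[ℝ] W) (SchwartzMap.fderivCLM ℝ V W f))
        p w v := by
  set f'' := SchwartzMap.fderivCLM ℝ V (V →L[ℝ] W) (SchwartzMap.fderivCLM ℝ V W f)
  have hint := integrable_momentXray_integrand k f'' hp
  have happly (v w : V) : momentXray k f'' p v w =
      ∫ t : ℝ, (t ^ k • f'' (p.2 + t • p.1)) v w := by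
    rw [momentXray, ContinuousLinearMap.integral_apply hint,
      ContinuousLinearMap.integral_apply (hint.apply_continuousLinearMap v)]
  rw [happly, happly]
  congr 1 with t
  have hsymm : f'' (p.2 + t • p.1) v w = f'' (p.2 + t • p.1) w v :=
    (f.smooth 2).contDiffAt.isSymmSndFDerivAt (by simp) v w
  simp [hsymm]

end MomentXray

lemma IsSchwartzField.exists_schwartzMap {F : E3 → E3} (hF : IsSchwartzField F) :
    ∃ f : 𝓢(E3, E3), ∀ x, F x = f x := by
  choose f hf using hF
  refine ⟨∑ i, (f i).postcompCLM
    (ContinuousLinearMap.toSpanSingleton ℝ (EuclideanSpace.single i (1 : ℝ))), fun x => ?_⟩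
  ext j
  fin_cases j <;> simp [Fin.sum_univ_three, hf]

/-- John's differential equation.  The X-ray transform
`g(θ, x) = ∫ F(x + sθ) ds` is smooth on `(ℝ³ \ {0}) × ℝ³` and its
mixed partial derivatives satisfy `∂²g/∂x_i∂θ_j = ∂²g/∂x_j∂θ_i`. -/
theorem johns_equation (F : E3 → E3) (hF : IsSchwartzField F)
    (g : E3 → E3 → E3) (hg : ∀ θ x, g θ x = ∫ s : ℝ, F (x + s • θ)) :
    ContDiffOn ℝ (⊤ : ℕ∞) (fun p : E3 × E3 => g p.1 p.2) (({0}ᶜ : Set E3) ×ˢ Set.univ) ∧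
    ∀ (i j : Fin 3) (θ : E3), θ ≠ 0 → ∀ x : E3,
      fderiv ℝ (fun x' => fderiv ℝ (fun θ' => g θ' x') θ (EuclideanSpace.single j 1)) x
          (EuclideanSpace.single i 1)
        = fderiv ℝ (fun x' => fderiv ℝ (fun θ' => g θ' x') θ (EuclideanSpace.single i 1)) x
          (EuclideanSpace.single j 1) := by
  obtain ⟨f, hf⟩ := hF.exists_schwartzMap
  have hgf (θ x : E3) : g θ x = momentXray 0 f (θ, x) := by
    simp [hg, momentXray, hf]
  simp only [hgf]
  refine ⟨contDiffOn_momentXray 0 f, fun i j θ hθ x => ?_⟩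
  have hmixed (v w : E3) :
      fderiv ℝ (fun x' => fderiv ℝ (fun θ' => momentXray 0 f (θ', x')) θ v) x w =
        momentXray 1 (SchwartzMap.fderivCLM ℝ E3 (E3 →L[ℝ] E3)
          (SchwartzMap.fderivCLM ℝ E3 E3 f)) (θ, x) w v := by
    simp only [(hasFDerivAt_momentXray_direction 0 f hθ _).fderiv]
    rw [((hasFDerivAt_momentXray_base 1 _ hθ x).clm_apply (hasFDerivAt_const v x)).fderiv]
    simp
  rw [hmixed, hmixed]
  exact momentXray_fderiv_fderiv_symm 1 f hθ _ _
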